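/- If Q is a non-zero homogeneous harmonic polynomial on ℝ^n of degree k ≥ 1 and Q₁ is a nonnegative polynomial divisor of Q (i.e., Q₁(x) ≥ 0 for all x), then Q₁ is constant. -/

import Mathlib

open MvPolynomial

open MeasureTheory ProbabilityTheory Finset

namespace MvPolynomial

variable {σ R : Type*} [CommSemiring R]

theorem pderiv_pderiv_comm (i j : σ) (p : MvPolynomial σ R) :
    pderiv i (pderiv j p) = pderiv j (pderiv i p) := by
  classical
  ext m
  rcases eq_or_ne i j with rfl | hij
  · rfl
  · simp only [coeff_pderiv, Finsupp.add_apply, Finsupp.single_eq_of_ne hij,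
      Finsupp.single_eq_of_ne hij.symm, add_right_comm m, add_zero, mul_right_comm]

theorem totalDegree_pderiv_le (i : σ) (p : MvPolynomial σ R) :
    (pderiv i p).totalDegree ≤ p.totalDegree - 1 := by
  classical
  refine Finset.sup_le fun m hm => ?_
  have hmem : m + Finsupp.single i 1 ∈ p.support := by
    rw [mem_support_iff, coeff_pderiv] at hm
    exact mem_support_iff.2 (left_ne_zero_of_mul hm)
  have hle := le_totalDegree hmem
  change Finsupp.degree (m + Finsupp.single i 1) ≤ _ at hle
  change Finsupp.degree m ≤ _
  rw [map_add, Finsupp.degree_single] at hle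
  omega

end MvPolynomial

theorem integrable_pow_mul_gaussianPDFReal (m : ℕ) :
    Integrable fun x : ℝ => x ^ m * gaussianPDFReal 0 1 x := by
  have h := integrable_rpow_mul_exp_neg_mul_sq (b := 1 / 2) (by norm_num) (s := m)
    (by have : (0 : ℝ) ≤ m := m.cast_nonneg
        linarith)
  refine (h.mul_const (√(2 * Real.pi * (1 : NNReal)))⁻¹).congr (ae_of_all _ fun x => ?_)
  simp only [gaussianPDFReal, Real.rpow_natCast, sub_zero, NNReal.coe_one]
  ring_nf

theorem hasDerivAt_gaussianPDFReal (x : ℝ) :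
    HasDerivAt (gaussianPDFReal 0 1) (-(x * gaussianPDFReal 0 1 x)) x := by
  have h : HasDerivAt (fun y : ℝ => -(y - 0) ^ 2 / (2 * (1 : NNReal))) (-x) x := by
    refine (((((hasDerivAt_id x).sub_const 0).pow 2).neg).div_const
      (2 * ((1 : NNReal) : ℝ))).congr_deriv ?_
    simp [neg_div]
  refine (h.exp.const_mul (√(2 * Real.pi * (1 : NNReal)))⁻¹).congr_deriv ?_
  rw [gaussianPDFReal]
  ring

theorem integral_pow_succ_gaussianReal (m : ℕ) :
    ∫ x, x ^ (m + 1) ∂gaussianReal 0 1 = m * ∫ x, x ^ (m - 1) ∂gaussianReal 0 1 := by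
  rw [integral_gaussianReal_eq_integral_smul one_ne_zero,
    integral_gaussianReal_eq_integral_smul one_ne_zero, ← integral_const_mul]
  have h := integral_mul_deriv_eq_deriv_mul_of_integrable
    (u := fun x : ℝ => x ^ m) (u' := fun x : ℝ => m * x ^ (m - 1))
    (v := gaussianPDFReal 0 1) (v' := fun x => -(x * gaussianPDFReal 0 1 x))
    (fun x _ => hasDerivAt_pow m x) (fun x _ => hasDerivAt_gaussianPDFReal x)
    (by
      refine (integrable_pow_mul_gaussianPDFReal (m + 1)).neg.congr (ae_of_all _ fun x => ?_)
      simp only [Pi.neg_apply, Pi.mul_apply]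
      ring)
    (by
      refine ((integrable_pow_mul_gaussianPDFReal (m - 1)).const_mul (m : ℝ)).congr
        (ae_of_all _ fun x => ?_)
      simp only [Pi.mul_apply]
      ring)
    (integrable_pow_mul_gaussianPDFReal m)
  rw [← neg_inj, ← integral_neg, neg_neg] at h
  refine Eq.trans (integral_congr_ae (ae_of_all _ fun x => ?_))
    (h.trans (integral_congr_ae (ae_of_all _ fun x => ?_)))
  · simp only [smul_eq_mul]
    ring
  · simp only [smul_eq_mul]
    ring

theorem integrable_pow_gaussianReal (m : ℕ) :
    Integrable (fun x : ℝ => x ^ m) (gaussianReal 0 1) := by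
  rw [gaussianReal_of_var_ne_zero _ one_ne_zero, integrable_withDensity_iff
    (measurable_gaussianPDF _ _) (ae_of_all _ fun _ => gaussianPDF_lt_top)]
  simpa only [toReal_gaussianPDF] using integrable_pow_mul_gaussianPDFReal m

instance : (gaussianReal 0 1).IsOpenPosMeasure :=
  (gaussianReal_absolutelyContinuous' 0 one_ne_zero).isOpenPosMeasure

namespace MvPolynomial

variable {σ : Type*} [Fintype σ]

theorem eval_monomial_eq_mul_prod (s : σ →₀ ℕ) (a : ℝ) (x : σ → ℝ) :
    eval x (monomial s a) = a * ∏ i, x i ^ s i := by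
  rw [eval_monomial, Finsupp.prod_fintype _ _ fun i => pow_zero _]

theorem integrable_eval_gaussian (p : MvPolynomial σ ℝ) :
    Integrable (fun x => eval x p) (Measure.pi fun _ : σ => gaussianReal 0 1) := by
  induction p using MvPolynomial.induction_on' with
  | add p q hp hq =>
    simp only [map_add]
    exact hp.add hq
  | monomial s a =>
    simp only [eval_monomial_eq_mul_prod]
    exact (Integrable.fintype_prod fun i => integrable_pow_gaussianReal (s i)).const_mul a

/-- The expectation of a real polynomial under the standard Gaussian measure. -/
noncomputable def gaussianExpectation : MvPolynomial σ ℝ →ₗ[ℝ] ℝ where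
  toFun p := ∫ x, eval x p ∂Measure.pi fun _ : σ => gaussianReal 0 1
  map_add' p q := by
    simp only [map_add]
    exact integral_add (integrable_eval_gaussian p) (integrable_eval_gaussian q)
  map_smul' c p := by
    simp only [smul_eval, RingHom.id_apply, smul_eq_mul]
    exact integral_const_mul c _

theorem gaussianExpectation_apply (p : MvPolynomial σ ℝ) :
    gaussianExpectation p = ∫ x, eval x p ∂Measure.pi fun _ : σ => gaussianReal 0 1 :=
  rfl

theorem gaussianExpectation_monomial (s : σ →₀ ℕ) (a : ℝ) :
    gaussianExpectation (monomial s a) = a * ∏ i, ∫ x, x ^ s i ∂gaussianReal 0 1 := by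
  simp only [gaussianExpectation_apply, eval_monomial_eq_mul_prod]
  rw [integral_const_mul, integral_fintype_prod_eq_prod (fun i (y : ℝ) => y ^ s i)]

/-- Gaussian integration by parts for polynomials. -/
theorem gaussianExpectation_X_mul (i : σ) (p : MvPolynomial σ ℝ) :
    gaussianExpectation (X i * p) = gaussianExpectation (pderiv i p) := by
  classical
  induction p using MvPolynomial.induction_on' with
  | add p q hp hq => simp only [mul_add, map_add, hp, hq]
  | monomial s a =>
    rw [pderiv_monomial, X, monomial_mul, one_mul, gaussianExpectation_monomial,
      gaussianExpectation_monomial, ← mul_prod_erase _ _ (mem_univ i),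
      ← mul_prod_erase _
        (fun j => ∫ x : ℝ, x ^ (s - Finsupp.single i 1 : σ →₀ ℕ) j ∂gaussianReal 0 1) (mem_univ i)]
    have hrest :
        ∏ j ∈ univ.erase i, ∫ x : ℝ, x ^ (Finsupp.single i 1 + s : σ →₀ ℕ) j ∂gaussianReal 0 1 =
          ∏ j ∈ univ.erase i, ∫ x : ℝ, x ^ (s - Finsupp.single i 1 : σ →₀ ℕ) j ∂gaussianReal 0 1 := by
      refine prod_congr rfl fun j hj => ?_
      simp [Finsupp.single_eq_of_ne (ne_of_mem_erase hj)]
    rw [hrest]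
    simp only [Finsupp.add_apply, Finsupp.tsub_apply, Finsupp.single_eq_same, add_comm 1,
      integral_pow_succ_gaussianReal]
    ring

/-- A homogeneous harmonic polynomial of degree `k` is orthogonal, for the standard Gaussian
measure, to every polynomial of degree less than `k`. -/
theorem gaussianExpectation_mul_eq_zero_of_harmonic {k : ℕ} {Q P : MvPolynomial σ ℝ}
    (hhom : Q.IsHomogeneous k) (hharm : ∑ i, pderiv i (pderiv i Q) = 0)
    (hP : P.totalDegree < k) : gaussianExpectation (Q * P) = 0 := by
  induction k generalizing Q P with
  | zero => omega
  | succ k ih =>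
    have hterm (i : σ) : gaussianExpectation (pderiv i Q * pderiv i P) = 0 := by
      rcases Nat.eq_zero_or_pos P.totalDegree with h0 | hpos
      · rw [totalDegree_eq_zero_iff_eq_C.1 h0, pderiv_C, mul_zero, map_zero]
      · refine ih (by simpa using hhom.pderiv (i := i)) ?_ ?_
        · have hcomm (j : σ) :
              pderiv j (pderiv j (pderiv i Q)) = pderiv i (pderiv j (pderiv j Q)) := by
            rw [pderiv_pderiv_comm j i Q, pderiv_pderiv_comm j i]
          simp only [hcomm, ← map_sum, hharm, map_zero]
        · have := totalDegree_pderiv_le i P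
          omega
    have hEuler : (k + 1) • (Q * P) = ∑ i, X i * (pderiv i Q * P) := by
      simp only [← smul_mul_assoc, ← hhom.sum_X_mul_pderiv, sum_mul, mul_assoc]
    have hsum : gaussianExpectation ((k + 1) • (Q * P)) = 0 := by
      rw [hEuler, map_sum]
      simp only [gaussianExpectation_X_mul, pderiv_mul, map_add, hterm, add_zero]
      rw [← map_sum, ← sum_mul, hharm, zero_mul, map_zero]
    rw [map_nsmul] at hsum
    exact (smul_eq_zero.1 hsum).resolve_left k.succ_ne_zero

theorem eq_zero_of_gaussianExpectation_eq_zero {p : MvPolynomial σ ℝ}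
    (hpos : ∀ x, 0 ≤ eval x p) (hp : gaussianExpectation p = 0) : p = 0 := by
  rw [gaussianExpectation_apply,
    integral_eq_zero_iff_of_nonneg hpos (integrable_eval_gaussian p)] at hp
  have h := (continuous_eval p).ae_eq_iff_eq _ continuous_zero |>.1 hp
  exact MvPolynomial.funext fun x => by simpa using congrFun h x

end MvPolynomial

/-- If `Q` is a non-zero homogeneous harmonic polynomial of degree `k ≥ 1` and `Q₁`
is a nonnegative polynomial divisor of `Q`, then `Q₁` is constant. -/
theorem stmt1 {n k : ℕ} (hk : 1 ≤ k) (Q Q₁ Q₂ : MvPolynomial (Fin n) ℝ)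
    (hQ0 : Q ≠ 0) (hhom : Q.IsHomogeneous k)
    (hharm : ∑ i : Fin n, pderiv i (pderiv i Q) = 0)
    (hdiv : Q = Q₁ * Q₂) (hpos : ∀ x : Fin n → ℝ, 0 ≤ eval x Q₁) :
    ∃ c : ℝ, Q₁ = C c := by
  have hne : Q₁ * Q₂ ≠ 0 := hdiv ▸ hQ0
  have hQ₂ := right_ne_zero_of_mul hne
  rcases Nat.eq_zero_or_pos Q₁.totalDegree with h0 | hdeg
  · exact ⟨_, totalDegree_eq_zero_iff_eq_C.1 h0⟩
  · have hsum := totalDegree_mul_of_isDomain (left_ne_zero_of_mul hne) hQ₂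
    rw [← hdiv, hhom.totalDegree hQ0] at hsum
    have hzero := gaussianExpectation_mul_eq_zero_of_harmonic hhom hharm
      (P := Q₂) (by omega)
    refine absurd (eq_zero_of_gaussianExpectation_eq_zero (fun x => ?_) hzero)
      (mul_ne_zero hQ0 hQ₂)
    rw [hdiv, mul_assoc, map_mul, map_mul]
    exact mul_nonneg (hpos x) (mul_self_nonneg _)
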